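/- For p ≥ 3 and any real coefficients a_1, …, a_n, the Haar series satisfies ‖Σ_{k=1}^n a_k h_k‖_{L^p[0,1]} ≤ 2^{1/2} (Γ((p+1)/2)/√π)^{1/p} · ‖(Σ_{k=1}^n a_k² h_k²)^{1/2}‖_{L^∞[0,1]}. -/

import Mathlib

open MeasureTheory
open scoped Classical

/-- The Haar system on `[0,1)`: `haar 1 ≡ 1` and for `m = 2^k + j`, `1 ≤ j ≤ 2^k`,
`haar m = 1` on `[(j-1)/2^k, (2j-1)/2^(k+1))`, `-1` on `[(2j-1)/2^(k+1), j/2^k)`,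
and `0` elsewhere. -/
noncomputable def haar (m : ℕ) (x : ℝ) : ℝ :=
  if m ≤ 1 then 1
  else
    let k := Nat.log 2 (m - 1)
    let j := m - 2 ^ k
    if ((j : ℝ) - 1) / 2 ^ k ≤ x ∧ x < (2 * (j : ℝ) - 1) / 2 ^ (k + 1) then 1
    else if (2 * (j : ℝ) - 1) / 2 ^ (k + 1) ≤ x ∧ x < (j : ℝ) / 2 ^ k then -1
    else 0

/-- The function `x ↦ |x| ^ q` is convex for `1 ≤ q`. -/
theorem convexOn_abs_rpow {q : ℝ} (hq : 1 ≤ q) :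
    ConvexOn ℝ Set.univ (fun x : ℝ => |x| ^ q) := by
  have hsub : (fun x : ℝ => |x|) '' Set.univ = Set.Ici 0 := by
    ext x
    refine ⟨?_, fun hx => ⟨x, trivial, abs_of_nonneg hx⟩⟩
    rintro ⟨y, -, rfl⟩
    exact abs_nonneg y
  refine ConvexOn.comp (g := fun x : ℝ => x ^ q) (f := fun x : ℝ => |x|) ?_
    (convexOn_univ_norm (E := ℝ)) ?_
  · rw [hsub]
    exact convexOn_rpow hq
  · rw [hsub]
    exact fun x hx z _ hxz => Real.rpow_le_rpow hx hxz (by linarith)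

/-- The even function `r ↦ |r + y| ^ q + |r - y| ^ q` increases on `[0, ∞)`. -/
theorem monotoneOn_abs_add_rpow_add_abs_sub_rpow {q : ℝ} (hq : 1 ≤ q) (y : ℝ) :
    MonotoneOn (fun r : ℝ => |r + y| ^ q + |r - y| ^ q) (Set.Ici 0) := by
  intro r hr s _ hrs
  have hr0 : (0 : ℝ) ≤ r := hr
  have h1 : ConvexOn ℝ Set.univ (fun r : ℝ => |r + y| ^ q) := by
    have h := (convexOn_abs_rpow hq).translate_left y
    rwa [Set.preimage_univ] at h
  have h2 : ConvexOn ℝ Set.univ (fun r : ℝ => |r - y| ^ q) := by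
    have h := (convexOn_abs_rpow hq).translate_left (-y)
    rwa [Set.preimage_univ] at h
  have h := (h1.add h2).le_max_of_mem_Icc (x := -s) (y := s) (z := r) trivial trivial
    ⟨by linarith, hrs⟩
  have e1 : |-s + y| = |s - y| := by rw [← abs_neg]; ring_nf
  have e2 : |-s - y| = |s + y| := by rw [← abs_neg]; ring_nf
  simp only [Pi.add_apply, e1, e2, add_comm (|s - y| ^ q), max_self] at h
  exact h

theorem hasDerivAt_abs_rpow_mul_self {q : ℝ} (hq : 0 < q) (x : ℝ) :
    HasDerivAt (fun x : ℝ => |x| ^ q * x) ((q + 1) * |x| ^ q) x := by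
  rcases eq_or_ne x 0 with rfl | hx
  · rw [hasDerivAt_iff_tendsto_slope]
    have hc : Continuous fun x : ℝ => |x| ^ q :=
      continuous_abs.rpow_const fun _ => Or.inr hq.le
    have h0 := (hc.tendsto 0).mono_left (nhdsWithin_le_nhds (s := {0}ᶜ))
    simp only [abs_zero, Real.zero_rpow hq.ne', mul_zero] at h0 ⊢
    refine h0.congr' ?_
    filter_upwards [self_mem_nhdsWithin] with z hz
    have hz' : z ≠ 0 := hz
    simp [slope_def_field, hz']
  · have h1 := ((hasDerivAt_abs hx).rpow_const (p := q)
      (Or.inl (abs_ne_zero.mpr hx))).mul (hasDerivAt_id x)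
    refine h1.congr_deriv ?_
    have e : ((SignType.sign x : SignType) : ℝ) * x = |x| := sign_mul_self x
    have e2 : |x| ^ (q - 1) * |x| = |x| ^ q := by
      rw [← Real.rpow_add_one (abs_ne_zero.mpr hx)]; ring_nf
    simp only [id, mul_one]
    calc _ = q * (|x| ^ (q - 1) * (SignType.sign x * x)) + |x| ^ q := by ring
      _ = _ := by rw [e, e2]; ring

/-- For `q ≥ 1` the function `r ↦ F (r + y) + F (r - y)`, `F x = |x| ^ q * x`, has
increasing slope from the origin. -/
theorem monotoneOn_abs_rpow_mul_div {q : ℝ} (hq : 1 ≤ q) (y : ℝ) :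
    MonotoneOn (fun r : ℝ => (|r + y| ^ q * (r + y) + |r - y| ^ q * (r - y)) / r)
      (Set.Ioi 0) := by
  set h : ℝ → ℝ := fun r => |r + y| ^ q * (r + y) + |r - y| ^ q * (r - y) with hh
  have hd : ∀ r, HasDerivAt h ((q + 1) * (|r + y| ^ q + |r - y| ^ q)) r := fun r => by
    have h1 := (hasDerivAt_abs_rpow_mul_self (q := q) (by linarith) (r + y)).comp_add_const r y
    have h2 := (hasDerivAt_abs_rpow_mul_self (q := q) (by linarith) (r - y)).comp_sub_const r y
    exact (h1.add h2).congr_deriv (by ring)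
  have hconv : ConvexOn ℝ (Set.Ici 0) h := by
    refine MonotoneOn.convexOn_of_deriv (convex_Ici 0)
      (fun r _ => (hd r).continuousAt.continuousWithinAt)
      (fun r _ => (hd r).differentiableAt.differentiableWithinAt) ?_
    rw [interior_Ici, funext fun r => (hd r).deriv]
    intro r hr s hs hrs
    have := monotoneOn_abs_add_rpow_add_abs_sub_rpow hq y (Set.Ioi_subset_Ici_self hr)
      (Set.Ioi_subset_Ici_self hs) hrs
    exact mul_le_mul_of_nonneg_left this (by linarith)
  have h0 : h 0 = 0 := by simp [hh]
  intro r hr s hs hrs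
  have := hconv.secant_mono (a := 0) (Set.mem_Ici.mpr le_rfl) (Set.Ioi_subset_Ici_self hr)
    (Set.Ioi_subset_Ici_self hs) (ne_of_gt hr) (ne_of_gt hs) hrs
  simpa [h0] using this

/-- For `p ≥ 3` the symmetrization of `|·| ^ p` about `y` is a convex function of the square of
the displacement. -/
theorem convexOn_abs_sqrt_add_rpow {p : ℝ} (hp : 3 ≤ p) (y : ℝ) :
    ConvexOn ℝ (Set.Ici 0) (fun u : ℝ => |√u + y| ^ p + |√u - y| ^ p) := by
  have hd : ∀ u : ℝ, 0 < u → HasDerivAt (fun u : ℝ => |√u + y| ^ p + |√u - y| ^ p)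
      (p / 2 * ((|√u + y| ^ (p - 2) * (√u + y) + |√u - y| ^ (p - 2) * (√u - y)) / √u)) u := by
    intro u hu
    have hs := Real.hasDerivAt_sqrt hu.ne'
    have h1 := (hasDerivAt_abs_rpow (√u + y) (p := p) (by linarith)).comp u (hs.add_const y)
    have h2 := (hasDerivAt_abs_rpow (√u - y) (p := p) (by linarith)).comp u (hs.sub_const y)
    refine (h1.add h2).congr_deriv ?_
    have : √u ≠ 0 := (Real.sqrt_pos.mpr hu).ne'
    field_simp
  have hc : Continuous (fun u : ℝ => |√u + y| ^ p + |√u - y| ^ p) := by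
    have hp0 : 0 ≤ p := by linarith
    fun_prop (disch := exact fun _ => Or.inr hp0)
  refine MonotoneOn.convexOn_of_deriv (convex_Ici 0) hc.continuousOn ?_ ?_
  · rw [interior_Ici]
    exact fun u hu => (hd u hu).differentiableAt.differentiableWithinAt
  · rw [interior_Ici]
    intro u hu v hv huv
    rw [(hd u hu).deriv, (hd v hv).deriv]
    exact mul_le_mul_of_nonneg_left (monotoneOn_abs_rpow_mul_div (q := p - 2) (by linarith) y
      (Real.sqrt_pos.mpr hu) (Real.sqrt_pos.mpr hv) (Real.sqrt_le_sqrt huv)) (by linarith)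

open ProbabilityTheory in
theorem integrable_abs_add_rpow_gaussianReal {p : ℝ} (hp : 0 ≤ p) (x : ℝ) (v : NNReal) :
    Integrable (fun z => |x + z| ^ p) (gaussianReal 0 v) := by
  have h : MemLp (fun z : ℝ => x + z) (ENNReal.ofReal p) (gaussianReal 0 v) :=
    (memLp_const x).add (memLp_id_gaussianReal' _ ENNReal.ofReal_ne_top)
  rcases hp.eq_or_lt with rfl | hp
  · simp
  have := h.integrable_norm_rpow (by simpa using hp) ENNReal.ofReal_ne_top
  simpa [ENNReal.toReal_ofReal hp.le] using this

/-- The extended-real-valued moment `𝔼 |x + Z| ^ p` of a centred Gaussian `Z` of variance `v`. -/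
noncomputable def gaussianMoment (p x : ℝ) (v : NNReal) : ENNReal :=
  ∫⁻ z, ENNReal.ofReal (|x + z| ^ p) ∂ProbabilityTheory.gaussianReal 0 v

theorem gaussianMoment_eq_ofReal {p : ℝ} (hp : 0 ≤ p) (x : ℝ) (v : NNReal) :
    gaussianMoment p x v =
      ENNReal.ofReal (∫ z, |x + z| ^ p ∂ProbabilityTheory.gaussianReal 0 v) :=
  (ofReal_integral_eq_lintegral_ofReal (integrable_abs_add_rpow_gaussianReal hp x v)
    (Filter.Eventually.of_forall fun _ => Real.rpow_nonneg (abs_nonneg _) _)).symm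

theorem measurable_ofReal_abs_add_rpow (p x : ℝ) :
    Measurable fun z : ℝ => ENNReal.ofReal (|x + z| ^ p) := by
  fun_prop

theorem gaussianMoment_neg (p x : ℝ) (v : NNReal) :
    gaussianMoment p (-x) v = gaussianMoment p x v := by
  have h : (ProbabilityTheory.gaussianReal 0 v).map (fun z => -z) =
      ProbabilityTheory.gaussianReal 0 v := by
    simpa using ProbabilityTheory.gaussianReal_map_neg (μ := 0) (v := v)
  rw [gaussianMoment, ← h, lintegral_map (measurable_ofReal_abs_add_rpow p _) measurable_neg,
    gaussianMoment]
  refine lintegral_congr fun z => ?_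
  rw [← abs_neg]
  ring_nf

/-- Jensen's inequality for the Gaussian moment. -/
theorem ofReal_abs_rpow_le_gaussianMoment {p : ℝ} (hp : 1 ≤ p) (x : ℝ) (v : NNReal) :
    ENNReal.ofReal (|x| ^ p) ≤ gaussianMoment p x v := by
  rw [gaussianMoment_eq_ofReal (by linarith)]
  refine ENNReal.ofReal_le_ofReal ?_
  have hid : Integrable (fun z : ℝ => z) (ProbabilityTheory.gaussianReal 0 v) :=
    (ProbabilityTheory.memLp_id_gaussianReal' 1 ENNReal.one_ne_top).integrable le_rfl
  have h := (convexOn_abs_rpow hp).map_integral_le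
    (μ := ProbabilityTheory.gaussianReal 0 v) (f := fun z => x + z)
    (continuous_abs.rpow_const fun _ => Or.inr (by linarith)).continuousOn isClosed_univ
    (Filter.Eventually.of_forall fun _ => trivial) ((integrable_const x).add hid)
    (integrable_abs_add_rpow_gaussianReal (by linarith) x v)
  rw [integral_add (integrable_const x) hid, ProbabilityTheory.integral_id_gaussianReal] at h
  simpa using h

/-- A symmetric two-point perturbation is dominated by the Gaussian of the same variance. -/
theorem ofReal_abs_add_rpow_add_le_gaussianMoment {p : ℝ} (hp : 3 ≤ p) (x d : ℝ) :
    ENNReal.ofReal (|x + d| ^ p) + ENNReal.ofReal (|x - d| ^ p) ≤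
      2 * gaussianMoment p x (d ^ 2).toNNReal := by
  have hp0 : 0 ≤ p := by linarith
  set v := (d ^ 2).toNNReal with hv
  have hvd : (v : ℝ) = d ^ 2 := Real.coe_toNNReal _ (sq_nonneg d)
  have hsym : ∀ z : ℝ, |√(z ^ 2) + x| ^ p + |√(z ^ 2) - x| ^ p = |x + z| ^ p + |-x + z| ^ p := by
    intro z
    rw [Real.sqrt_sq_eq_abs]
    rcases abs_choice z with h | h <;> rw [h]
    · congr 3 <;> ring
    · rw [add_comm]
      congr 2 <;> rw [← abs_neg] <;> ring_nf
  have i1 := integrable_abs_add_rpow_gaussianReal hp0 x v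
  have i2 := integrable_abs_add_rpow_gaussianReal hp0 (-x) v
  have hc : Continuous (fun u : ℝ => |√u + x| ^ p + |√u - x| ^ p) := by
    fun_prop (disch := exact fun _ => Or.inr hp0)
  have hsq : Integrable (fun z : ℝ => z ^ 2) (ProbabilityTheory.gaussianReal 0 v) :=
    (ProbabilityTheory.memLp_id_gaussianReal' 2 (by simp)).integrable_sq
  have hvar : ∫ z, z ^ 2 ∂ProbabilityTheory.gaussianReal 0 v = d ^ 2 := by
    have h := ProbabilityTheory.variance_of_integral_eq_zero (X := id)
      (μ := ProbabilityTheory.gaussianReal 0 v) aemeasurable_id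
      (by simp)
    rw [ProbabilityTheory.variance_id_gaussianReal, hvd] at h
    simpa using h.symm
  have h := (convexOn_abs_sqrt_add_rpow hp x).map_integral_le
    (μ := ProbabilityTheory.gaussianReal 0 v) (f := fun z => z ^ 2) hc.continuousOn isClosed_Ici
    (Filter.Eventually.of_forall fun z => sq_nonneg z) hsq
    ((i1.add i2).congr (Filter.Eventually.of_forall fun z => (hsym z).symm))
  simp only [hvar, hsym] at h
  rw [integral_add i1 i2] at h
  rw [two_mul]
  nth_rewrite 2 [← gaussianMoment_neg]
  rw [gaussianMoment_eq_ofReal hp0, gaussianMoment_eq_ofReal hp0, ← ENNReal.ofReal_add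
    (by positivity) (by positivity), ← ENNReal.ofReal_add
    (integral_nonneg fun _ => by positivity) (integral_nonneg fun _ => by positivity)]
  refine ENNReal.ofReal_le_ofReal (le_of_eq_of_le ?_ h)
  congr 2
  rw [← abs_neg]
  ring_nf

theorem gaussianMoment_add_add_gaussianMoment_sub_le {p : ℝ} (hp : 3 ≤ p) (x d : ℝ)
    (s : NNReal) :
    gaussianMoment p (x + d) s + gaussianMoment p (x - d) s ≤
      2 * gaussianMoment p x (s + (d ^ 2).toNNReal) := by
  have hconv : ProbabilityTheory.gaussianReal 0 (s + (d ^ 2).toNNReal) =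
      (ProbabilityTheory.gaussianReal 0 s).conv
        (ProbabilityTheory.gaussianReal 0 (d ^ 2).toNNReal) := by
    simpa using (ProbabilityTheory.gaussianReal_conv_gaussianReal (m₁ := 0) (m₂ := 0)
      (v₁ := s) (v₂ := (d ^ 2).toNNReal)).symm
  calc gaussianMoment p (x + d) s + gaussianMoment p (x - d) s
      = ∫⁻ z, ENNReal.ofReal (|x + z + d| ^ p) + ENNReal.ofReal (|x + z - d| ^ p)
          ∂ProbabilityTheory.gaussianReal 0 s := by
        rw [gaussianMoment, gaussianMoment,
          ← lintegral_add_left (measurable_ofReal_abs_add_rpow p _)]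
        refine lintegral_congr fun z => ?_
        rw [add_right_comm, sub_add_eq_add_sub]
    _ ≤ ∫⁻ z, 2 * gaussianMoment p (x + z) (d ^ 2).toNNReal
          ∂ProbabilityTheory.gaussianReal 0 s :=
        lintegral_mono fun z => ofReal_abs_add_rpow_add_le_gaussianMoment hp _ d
    _ = 2 * gaussianMoment p x (s + (d ^ 2).toNNReal) := by
        rw [lintegral_const_mul' _ _ (by simp)]
        unfold gaussianMoment
        rw [hconv, Measure.lintegral_conv (measurable_ofReal_abs_add_rpow p _)]
        simp only [add_assoc]

/-- The absolute moments of a centred Gaussian. -/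
theorem gaussianMoment_zero {p : ℝ} (hp : 0 < p) (v : NNReal) :
    gaussianMoment p 0 v =
      ENNReal.ofReal ((2 * v) ^ (p / 2) * (Real.Gamma ((p + 1) / 2) / √Real.pi)) := by
  rw [gaussianMoment_eq_ofReal hp.le]
  congr 1
  rcases eq_or_ne v 0 with rfl | hv
  · have : p / 2 ≠ 0 := by positivity
    simp [ProbabilityTheory.gaussianReal_zero_var, Real.zero_rpow hp.ne', Real.zero_rpow this]
  have hv0 : (0 : ℝ) < v := by positivity
  rw [ProbabilityTheory.integral_gaussianReal_eq_integral_smul hv]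
  have habs : ∀ z : ℝ, ProbabilityTheory.gaussianPDFReal 0 v z • |0 + z| ^ p =
      (√(2 * Real.pi * v))⁻¹ * (|z| ^ p * Real.exp (-(1 / (2 * v)) * |z| ^ (2 : ℝ))) := by
    intro z
    have : -(z - 0) ^ 2 / (2 * (v : ℝ)) = -(1 / (2 * v)) * |z| ^ (2 : ℝ) := by
      rw [Real.rpow_two, sq_abs]
      ring
    rw [ProbabilityTheory.gaussianPDFReal, this, zero_add, smul_eq_mul]
    ring
  simp_rw [habs]
  rw [integral_const_mul,
    integral_comp_abs (f := fun z => z ^ p * Real.exp (-(1 / (2 * v)) * z ^ (2 : ℝ))),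
    integral_rpow_mul_exp_neg_mul_rpow (by norm_num) (by linarith) (by positivity)]
  have h2v : (0 : ℝ) < 2 * v := by positivity
  have e1 : (1 / (2 * (v : ℝ))) ^ (-(p + 1) / 2) = (2 * v) ^ (p / 2) * √(2 * v) := by
    rw [one_div, Real.inv_rpow h2v.le, ← Real.rpow_neg h2v.le, Real.sqrt_eq_rpow,
      ← Real.rpow_add h2v]
    ring_nf
  have e2 : √(2 * Real.pi * v) = √(2 * v) * √Real.pi := by
    rw [← Real.sqrt_mul h2v.le]
    ring_nf
  rw [e1, e2]
  have : √(2 * (v : ℝ)) ≠ 0 := (Real.sqrt_pos.mpr h2v).ne'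
  field_simp

theorem haar_one (x : ℝ) : haar 1 x = 1 := by simp [haar]

theorem haar_of_two_pow_add {k j : ℕ} (hj : 1 ≤ j) (hjk : j ≤ 2 ^ k) (x : ℝ) :
    haar (2 ^ k + j) x =
      if ((j : ℝ) - 1) / 2 ^ k ≤ x ∧ x < (2 * (j : ℝ) - 1) / 2 ^ (k + 1) then 1
      else if (2 * (j : ℝ) - 1) / 2 ^ (k + 1) ≤ x ∧ x < (j : ℝ) / 2 ^ k then -1
      else 0 := by
  have h2 : 0 < 2 ^ k := by positivity
  have hlog : Nat.log 2 (2 ^ k + j - 1) = k :=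
    Nat.log_eq_of_pow_le_of_lt_pow (by omega) (by rw [pow_succ]; omega)
  have hn : ¬ 2 ^ k + j ≤ 1 := by omega
  simp only [haar, hn, if_false, hlog, Nat.add_sub_cancel_left]

theorem exists_eq_two_pow_add {m : ℕ} (hm : 2 ≤ m) :
    ∃ k j : ℕ, 1 ≤ j ∧ j ≤ 2 ^ k ∧ m = 2 ^ k + j := by
  have h1 : 2 ^ Nat.log 2 (m - 1) ≤ m - 1 := Nat.pow_log_le_self 2 (by omega)
  have h2 : m - 1 < 2 ^ (Nat.log 2 (m - 1) + 1) := Nat.lt_pow_succ_log_self (by norm_num) _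
  rw [pow_succ] at h2
  exact ⟨Nat.log 2 (m - 1), m - 2 ^ Nat.log 2 (m - 1), by omega, by omega, by omega⟩

theorem measurable_haar (m : ℕ) : Measurable (haar m) := by
  rcases lt_or_ge m 2 with hm | hm
  · have : haar m = fun _ => 1 := by
      ext x
      simp [haar, Nat.lt_succ_iff.mp hm]
    rw [this]
    exact measurable_const
  · obtain ⟨k, j, hj, hjk, rfl⟩ := exists_eq_two_pow_add hm
    rw [funext (haar_of_two_pow_add hj hjk)]
    exact Measurable.ite measurableSet_Ico measurable_const
      (Measurable.ite measurableSet_Ico measurable_const measurable_const)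

theorem haar_sq_le_one (m : ℕ) (x : ℝ) : haar m x ^ 2 ≤ 1 := by
  simp only [haar]
  split_ifs <;> norm_num

/-- A dyadic rational of level `i ≤ k` does not separate points of a dyadic interval of
level `k`. -/
theorem div_two_pow_le_iff {i k : ℕ} (hik : i ≤ k) (c N : ℤ) {x : ℝ}
    (hx : x ∈ Set.Ico ((N : ℝ) / 2 ^ k) ((N + 1) / 2 ^ k)) :
    (c : ℝ) / 2 ^ i ≤ x ↔ c * 2 ^ (k - i) ≤ N := by
  obtain ⟨d, rfl⟩ := Nat.exists_eq_add_of_le hik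
  have h2 : (0 : ℝ) < 2 ^ (i + d) := by positivity
  have hc : (c : ℝ) / 2 ^ i = ((c * 2 ^ d : ℤ) : ℝ) / 2 ^ (i + d) := by
    push_cast
    rw [pow_add, mul_div_mul_right _ _ (by positivity)]
  rw [Nat.add_sub_cancel_left, hc]
  constructor
  · intro h
    have h3 := (div_lt_div_iff_of_pos_right h2).mp (h.trans_lt hx.2)
    exact Int.lt_add_one_iff.mp (by exact_mod_cast h3)
  · intro h
    refine le_trans ((div_le_div_iff_of_pos_right h2).mpr ?_) hx.1
    exact_mod_cast h

/-- Earlier Haar functions are constant on the support of a later one. -/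
theorem haar_eq_of_mem_Ico {k j l : ℕ} (hl : 1 ≤ l) (hlm : l < 2 ^ k + j)
    (hjk : j ≤ 2 ^ k) {x y : ℝ}
    (hx : x ∈ Set.Ico (((j : ℝ) - 1) / 2 ^ k) ((j : ℝ) / 2 ^ k))
    (hy : y ∈ Set.Ico (((j : ℝ) - 1) / 2 ^ k) ((j : ℝ) / 2 ^ k)) :
    haar l x = haar l y := by
  rcases hl.eq_or_lt with rfl | hl
  · rw [haar_one, haar_one]
  obtain ⟨i, r, hr, hri, rfl⟩ := exists_eq_two_pow_add hl
  have hik : i ≤ k := by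
    have : 2 ^ i < 2 ^ (k + 1) := by rw [pow_succ]; omega
    exact Nat.lt_succ_iff.mp ((Nat.pow_lt_pow_iff_right (by norm_num)).mp this)
  rw [haar_of_two_pow_add hr hri, haar_of_two_pow_add hr hri]
  rcases hik.eq_or_lt with rfl | hik
  · have hrj : (r : ℝ) + 1 ≤ j := by exact_mod_cast (by omega : r + 1 ≤ j)
    have h2 : (0 : ℝ) < 2 ^ i := by positivity
    have key : ∀ z ∈ Set.Ico (((j : ℝ) - 1) / 2 ^ i) ((j : ℝ) / 2 ^ i),
        (r : ℝ) / 2 ^ i ≤ z ∧ (2 * (r : ℝ) - 1) / 2 ^ (i + 1) ≤ z := by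
      intro z hz
      have h1 : (r : ℝ) / 2 ^ i ≤ z :=
        le_trans ((div_le_div_iff_of_pos_right h2).mpr (by linarith)) hz.1
      refine ⟨h1, le_trans ?_ h1⟩
      rw [div_le_div_iff₀ (by positivity) h2, pow_succ]
      nlinarith
    rw [if_neg fun h => absurd h.2 (not_lt.mpr (key x hx).2),
      if_neg fun h => absurd h.2 (not_lt.mpr (key x hx).1),
      if_neg fun h => absurd h.2 (not_lt.mpr (key y hy).2),
      if_neg fun h => absurd h.2 (not_lt.mpr (key y hy).1)]
  · have hxy : ∀ e ≤ k, ∀ c : ℤ, (c : ℝ) / 2 ^ e ≤ x ↔ (c : ℝ) / 2 ^ e ≤ y := by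
      intro e he c
      rw [div_two_pow_le_iff he c ((j : ℤ) - 1) (by simpa using hx),
        div_two_pow_le_iff he c ((j : ℤ) - 1) (by simpa using hy)]
    have h1 := hxy i hik.le ((r : ℤ) - 1)
    have h2 := hxy (i + 1) hik (2 * (r : ℤ) - 1)
    have h3 := hxy i hik.le (r : ℤ)
    push_cast at h1 h2 h3
    simp only [← not_le, h1, h2, h3]

/-- Adding a function that is `b`, `-b` on the two halves of an interval where `f` and the
remaining variance are constant does not increase the integrated Gaussian moment. -/
theorem lintegral_gaussianMoment_add_le {p : ℝ} (hp : 3 ≤ p) {S : Set ℝ} {f q h : ℝ → ℝ}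
    {u v w b T c Q : ℝ} (huv : u ≤ v) (hvw : w - v = v - u) (hSm : MeasurableSet S)
    (hS : Set.Ico u w ⊆ S)
    (hf : ∀ x ∈ Set.Ico u w, f x = c) (hq : ∀ x ∈ Set.Ico u w, q x = Q)
    (hL : ∀ x ∈ Set.Ico u v, h x = 1) (hR : ∀ x ∈ Set.Ico v w, h x = -1)
    (h0 : ∀ x ∉ Set.Ico u w, h x = 0) (hT : Q + b ^ 2 ≤ T) :
    ∫⁻ x in S, gaussianMoment p (f x + b * h x) (T - (q x + b ^ 2 * h x ^ 2)).toNNReal ≤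
      ∫⁻ x in S, gaussianMoment p (f x) (T - q x).toNNReal := by
  have hunion : Set.Ico u v ∪ Set.Ico v w = Set.Ico u w :=
    Set.Ico_union_Ico_eq_Ico huv (by linarith)
  have hsubL : Set.Ico u v ⊆ Set.Ico u w := hunion ▸ Set.subset_union_left
  have hsubR : Set.Ico v w ⊆ Set.Ico u w := hunion ▸ Set.subset_union_right
  rw [← lintegral_inter_add_sdiff _ S (measurableSet_Ico (a := u) (b := w)),
    ← lintegral_inter_add_sdiff (fun x => gaussianMoment p (f x) (T - q x).toNNReal) S
      (measurableSet_Ico (a := u) (b := w)),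
    Set.inter_eq_self_of_subset_right hS]
  refine add_le_add ?_ ?_
  · rw [← hunion, lintegral_union measurableSet_Ico Set.Ico_disjoint_Ico_same,
      lintegral_union measurableSet_Ico Set.Ico_disjoint_Ico_same]
    have e1 : ∫⁻ x in Set.Ico u v,
        gaussianMoment p (f x + b * h x) (T - (q x + b ^ 2 * h x ^ 2)).toNNReal =
        gaussianMoment p (c + b) (T - Q - b ^ 2).toNNReal * ENNReal.ofReal (v - u) := by
      rw [← Real.volume_Ico, ← setLIntegral_const]
      refine setLIntegral_congr_fun measurableSet_Ico fun x hx => ?_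
      simp only [hf x (hsubL hx), hq x (hsubL hx), hL x hx]
      ring_nf
    have e2 : ∫⁻ x in Set.Ico v w,
        gaussianMoment p (f x + b * h x) (T - (q x + b ^ 2 * h x ^ 2)).toNNReal =
        gaussianMoment p (c - b) (T - Q - b ^ 2).toNNReal * ENNReal.ofReal (v - u) := by
      rw [← hvw, ← Real.volume_Ico, ← setLIntegral_const]
      refine setLIntegral_congr_fun measurableSet_Ico fun x hx => ?_
      simp only [hf x (hsubR hx), hq x (hsubR hx), hR x hx]
      ring_nf
    have e3 : ∫⁻ x in Set.Ico u v, gaussianMoment p (f x) (T - q x).toNNReal =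
        gaussianMoment p c (T - Q).toNNReal * ENNReal.ofReal (v - u) := by
      rw [← Real.volume_Ico, ← setLIntegral_const]
      exact setLIntegral_congr_fun measurableSet_Ico fun x hx => by
        simp only [hf x (hsubL hx), hq x (hsubL hx)]
    have e4 : ∫⁻ x in Set.Ico v w, gaussianMoment p (f x) (T - q x).toNNReal =
        gaussianMoment p c (T - Q).toNNReal * ENNReal.ofReal (v - u) := by
      rw [← hvw, ← Real.volume_Ico, ← setLIntegral_const]
      exact setLIntegral_congr_fun measurableSet_Ico fun x hx => by
        simp only [hf x (hsubR hx), hq x (hsubR hx)]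
    rw [e1, e2, e3, e4, ← add_mul, ← two_mul, ← mul_assoc]
    gcongr
    have := gaussianMoment_add_add_gaussianMoment_sub_le hp c b (T - Q - b ^ 2).toNNReal
    rwa [← Real.toNNReal_add (by linarith) (sq_nonneg b), sub_add_cancel] at this
  · refine le_of_eq (setLIntegral_congr_fun (hSm.diff measurableSet_Ico) fun x hx => ?_)
    simp only [h0 x hx.2]
    ring_nf

/-- Along the partial sums of a Haar series whose square function is at most `√T`, the Gaussian
moment with the remaining variance is bounded by its initial value. -/
theorem lintegral_gaussianMoment_haar_le {p : ℝ} (hp : 3 ≤ p) {n : ℕ} (a : ℕ → ℝ) {T : ℝ}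
    (hT : ∀ᵐ x ∂volume.restrict (Set.Ico (0 : ℝ) 1),
      ∑ k ∈ Finset.Icc 1 n, (a k) ^ 2 * (haar k x) ^ 2 ≤ T) :
    ∀ m ≤ n, ∫⁻ x in Set.Ico (0 : ℝ) 1, gaussianMoment p (∑ k ∈ Finset.Icc 1 m, a k * haar k x)
        (T - ∑ k ∈ Finset.Icc 1 m, (a k) ^ 2 * (haar k x) ^ 2).toNNReal ≤
      gaussianMoment p 0 T.toNNReal := by
  have hpt : ∀ m ≤ n, ∀ u v : ℝ, u < v → Set.Ico u v ⊆ Set.Ico 0 1 →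
      ∃ x ∈ Set.Ico u v, ∑ k ∈ Finset.Icc 1 m, (a k) ^ 2 * (haar k x) ^ 2 ≤ T := by
    intro m hm u v huv hsub
    by_contra! hcon
    have h0 : ∀ᵐ x ∂volume.restrict (Set.Ico u v), False := by
      filter_upwards [ae_restrict_of_ae_restrict_of_subset hsub hT,
        ae_restrict_mem measurableSet_Ico] with x hx hxI
      refine absurd ((hcon x hxI).trans_le (le_trans ?_ hx)) (lt_irrefl _)
      exact Finset.sum_le_sum_of_subset_of_nonneg (Finset.Icc_subset_Icc_right hm)
        fun _ _ _ => by positivity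
    rw [Filter.eventually_false_iff_eq_bot, ae_eq_bot, Measure.restrict_eq_zero,
      Real.volume_Ico, ENNReal.ofReal_eq_zero] at h0
    linarith
  intro m
  induction m with
  | zero => simp
  | succ m ih =>
    intro hm
    refine le_trans ?_ (ih (by omega))
    simp only [Finset.sum_Icc_succ_top (Nat.le_add_left 1 m)]
    rcases Nat.eq_zero_or_pos m with rfl | hm0
    · refine lintegral_mono fun x => ?_
      obtain ⟨y, -, hy⟩ := hpt 1 hm 0 1 one_pos subset_rfl
      simp only [Finset.Icc_self, Finset.sum_singleton, haar_one] at hy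
      have h := gaussianMoment_add_add_gaussianMoment_sub_le hp 0 (a 1) (T - a 1 ^ 2).toNNReal
      rw [zero_sub, gaussianMoment_neg, zero_add, ← two_mul,
        ← Real.toNNReal_add (by linarith) (sq_nonneg _), sub_add_cancel] at h
      simpa [haar_one] using (ENNReal.mul_le_mul_iff_right (by simp) (by simp)).mp h
    · obtain ⟨k, j, hj, hjk, hkj⟩ := exists_eq_two_pow_add (m := m + 1) (by omega)
      have h2 : (0 : ℝ) < 2 ^ k := by positivity
      have hj1 : (1 : ℝ) ≤ j := by exact_mod_cast hj
      have hjk' : (j : ℝ) ≤ 2 ^ k := by exact_mod_cast hjk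
      set u : ℝ := ((j : ℝ) - 1) / 2 ^ k with hu
      set w : ℝ := (j : ℝ) / 2 ^ k with hw
      set v : ℝ := (2 * (j : ℝ) - 1) / 2 ^ (k + 1) with hv
      have hvu : v - u = 1 / 2 ^ (k + 1) := by
        rw [hu, hv, pow_succ]
        field_simp
        ring
      have hwv : w - v = 1 / 2 ^ (k + 1) := by
        rw [hw, hv, pow_succ]
        field_simp
        ring
      have hpos : (0 : ℝ) < 1 / 2 ^ (k + 1) := by positivity
      have hsub : Set.Ico u w ⊆ Set.Ico 0 1 :=
        Set.Ico_subset_Ico (div_nonneg (by linarith) h2.le) ((div_le_one h2).mpr hjk')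
      have huw : u ∈ Set.Ico u w := ⟨le_rfl, by linarith⟩
      have hconst : ∀ x ∈ Set.Ico u w, ∀ l ∈ Finset.Icc 1 m, haar l x = haar l u :=
        fun x hx l hl => haar_eq_of_mem_Ico (Finset.mem_Icc.mp hl).1
          (by have := (Finset.mem_Icc.mp hl).2; omega) hjk hx huw
      have hL : ∀ x ∈ Set.Ico u v, haar (m + 1) x = 1 := fun x hx => by
        rw [hkj, haar_of_two_pow_add hj hjk]
        exact if_pos hx
      refine lintegral_gaussianMoment_add_le hp (u := u) (v := v) (w := w)
        (c := ∑ l ∈ Finset.Icc 1 m, a l * haar l u)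
        (Q := ∑ l ∈ Finset.Icc 1 m, (a l) ^ 2 * (haar l u) ^ 2) (by linarith) (by linarith)
        measurableSet_Ico hsub
        (fun x hx => Finset.sum_congr rfl fun l hl => by rw [hconst x hx l hl])
        (fun x hx => Finset.sum_congr rfl fun l hl => by rw [hconst x hx l hl])
        hL (fun x hx => ?_) (fun x hx => ?_) ?_
      · rw [hkj, haar_of_two_pow_add hj hjk, if_neg fun h => absurd h.2 (not_lt.mpr hx.1)]
        exact if_pos hx
      · rw [hkj, haar_of_two_pow_add hj hjk,
          if_neg fun h => hx ⟨h.1, h.2.trans (by linarith)⟩,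
          if_neg fun h => hx ⟨le_trans (by linarith) h.1, h.2⟩]
      · have hIv : Set.Ico u v ⊆ Set.Ico u w := Set.Ico_subset_Ico_right (by linarith)
        obtain ⟨x, hx, hxT⟩ := hpt (m + 1) hm u v (by linarith) (hIv.trans hsub)
        rw [Finset.sum_Icc_succ_top (Nat.le_add_left 1 m), hL x hx, one_pow, mul_one] at hxT
        rwa [Finset.sum_congr rfl fun l hl => by rw [hconst x (hIv hx) l hl]] at hxT

/-- Khintchine-type inequality for Haar series: for `p ≥ 3`,
`‖Σ a_k h_k‖_p ≤ 2^(1/2) (Γ((p+1)/2)/√π)^(1/p) ‖(Σ a_k² h_k²)^(1/2)‖_∞`. -/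
theorem stmt_15 (p : ℝ) (hp : 3 ≤ p) (n : ℕ) (hn : 1 ≤ n) (a : ℕ → ℝ) :
    (∫ x in Set.Ico (0 : ℝ) 1, |∑ k ∈ Finset.Icc 1 n, a k * haar k x| ^ p) ^ (1 / p) ≤
      Real.sqrt 2 * (Real.Gamma ((p + 1) / 2) / Real.sqrt Real.pi) ^ (1 / p) *
        (eLpNorm
            (fun x => Real.sqrt (∑ k ∈ Finset.Icc 1 n, (a k) ^ 2 * (haar k x) ^ 2)) ⊤
            (volume.restrict (Set.Ico (0 : ℝ) 1))).toReal := by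
  have hp0 : 0 < p := by linarith
  set E := eLpNorm (fun x => Real.sqrt (∑ k ∈ Finset.Icc 1 n, (a k) ^ 2 * (haar k x) ^ 2)) ⊤
    (volume.restrict (Set.Ico (0 : ℝ) 1)) with hE
  have hEtop : E ≠ ⊤ := by
    refine ne_top_of_le_ne_top ENNReal.ofReal_ne_top (eLpNormEssSup_le_of_ae_bound
      (C := √(∑ k ∈ Finset.Icc 1 n, (a k) ^ 2)) (Filter.Eventually.of_forall fun x => ?_))
    rw [Real.norm_of_nonneg (Real.sqrt_nonneg _)]
    exact Real.sqrt_le_sqrt (Finset.sum_le_sum fun k _ =>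
      mul_le_of_le_one_right (sq_nonneg _) (haar_sq_le_one k x))
  set M := E.toReal with hM
  have hM0 : 0 ≤ M := ENNReal.toReal_nonneg
  have hbound : ∀ᵐ x ∂volume.restrict (Set.Ico (0 : ℝ) 1),
      ∑ k ∈ Finset.Icc 1 n, (a k) ^ 2 * (haar k x) ^ 2 ≤ M ^ 2 := by
    filter_upwards [ae_le_eLpNormEssSup (μ := volume.restrict (Set.Ico (0 : ℝ) 1))
      (f := fun x => Real.sqrt (∑ k ∈ Finset.Icc 1 n, (a k) ^ 2 * (haar k x) ^ 2))] with x hx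
    rw [← eLpNorm_exponent_top, ← hE, Real.enorm_of_nonneg (Real.sqrt_nonneg _),
      ENNReal.ofReal_le_iff_le_toReal hEtop] at hx
    exact (Real.sqrt_le_left hM0).mp hx
  set C := Real.Gamma ((p + 1) / 2) / √Real.pi with hC
  have hC0 : 0 ≤ C := div_nonneg (Real.Gamma_nonneg_of_nonneg (by linarith)) (Real.sqrt_nonneg _)
  have hlin : ∫⁻ x in Set.Ico (0 : ℝ) 1,
      ENNReal.ofReal (|∑ k ∈ Finset.Icc 1 n, a k * haar k x| ^ p) ≤
        ENNReal.ofReal ((2 * M ^ 2) ^ (p / 2) * C) := by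
    refine (lintegral_mono fun x => ofReal_abs_rpow_le_gaussianMoment (by linarith) _ _).trans
      ((lintegral_gaussianMoment_haar_le hp a hbound n le_rfl).trans_eq ?_)
    rw [gaussianMoment_zero hp0, Real.coe_toNNReal _ (sq_nonneg M)]
  have hmeas : Measurable fun x : ℝ => |∑ k ∈ Finset.Icc 1 n, a k * haar k x| ^ p := by
    have := measurable_haar
    fun_prop
  rw [integral_eq_lintegral_of_nonneg_ae
    (Filter.Eventually.of_forall fun x => Real.rpow_nonneg (abs_nonneg _) _)
    hmeas.aestronglyMeasurable]
  have hroot : ((2 * M ^ 2) ^ (p / 2) * C) ^ (1 / p) = √2 * C ^ (1 / p) * M := by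
    rw [Real.mul_rpow (by positivity) hC0, ← Real.rpow_mul (by positivity),
      show p / 2 * (1 / p) = 1 / 2 by field_simp, ← Real.sqrt_eq_rpow,
      Real.sqrt_mul (by norm_num), Real.sqrt_sq hM0]
    ring
  rw [← hroot]
  exact Real.rpow_le_rpow ENNReal.toReal_nonneg
    (ENNReal.toReal_le_of_le_ofReal (by positivity) hlin) (by positivity)
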